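/- For every T ∈ H one has ρ*(T) = π ∘ ρ(T^T) as linear maps 𝒵 → 𝒵. Consequently, for every s ∈ ℝ^r: Δ_s(x) = δ_{−s}(π(x^{−1})) for all x ∈ 𝒫, or equivalently Δ_s(ξ̂^{−1}) = δ_{−s}(ξ) for all ξ ∈ 𝒬. -/

import Mathlib

open Matrix MeasureTheory Finset
open scoped ENNReal

namespace Wishart

instance {m n α : Type*} [MeasurableSpace α] : MeasurableSpace (Matrix m n α) :=
  inferInstanceAs (MeasurableSpace (m → n → α))

/-- Index set of an `N × N` matrix partitioned into `r + 1` blocks of sizes `n 0, …, n r`. -/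
abbrev Idx (r : ℕ) (n : Fin (r + 1) → ℕ+) := Σ k : Fin (r + 1), Fin (n k)

/-- Real matrices over the partitioned index set. -/
abbrev Mat (r : ℕ) (n : Fin (r + 1) → ℕ+) := Matrix (Idx r n) (Idx r n) ℝ

variable {r : ℕ} {n : Fin (r + 1) → ℕ+}

/-- The `(l,k)` block of a partitioned matrix. -/
def blk (x : Mat r n) (l k : Fin (r + 1)) : Matrix (Fin (n l)) (Fin (n k)) ℝ :=
  Matrix.of fun a b => x ⟨l, a⟩ ⟨k, b⟩

variable (V : ∀ l k : Fin (r + 1), Submodule ℝ (Matrix (Fin (n l)) (Fin (n k)) ℝ))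

/-- Condition (V1): `A ∈ 𝒱_{lk}`, `B ∈ 𝒱_{ki}` implies `A B ∈ 𝒱_{li}` for `i < k < l`. -/
def CondV1 : Prop := ∀ i k l : Fin (r + 1), i < k → k < l →
  ∀ A ∈ V l k, ∀ B ∈ V k i, A * B ∈ V l i

/-- Condition (V2): `A ∈ 𝒱_{li}`, `B ∈ 𝒱_{ki}` implies `A Bᵀ ∈ 𝒱_{lk}` for `i < k < l`. -/
def CondV2 : Prop := ∀ i k l : Fin (r + 1), i < k → k < l →
  ∀ A ∈ V l i, ∀ B ∈ V k i, A * Bᵀ ∈ V l k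

/-- Condition (V3): `A ∈ 𝒱_{lk}` implies `A Aᵀ ∈ ℝ I`. -/
def CondV3 : Prop := ∀ k l : Fin (r + 1), k < l →
  ∀ A ∈ V l k, ∃ c : ℝ, A * Aᵀ = c • (1 : Matrix (Fin (n l)) (Fin (n l)) ℝ)

/-- The space `𝒵` of symmetric matrices with lower blocks in `𝒱_{lk}` and scalar diagonal
blocks. -/
def Zspace : Set (Mat r n) :=
  {x | x.IsSymm ∧ (∀ k l : Fin (r + 1), k < l → blk x l k ∈ V l k) ∧
    ∀ k : Fin (r + 1), ∃ c : ℝ, ∀ a b : Fin (n k),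
      x ⟨k, a⟩ ⟨k, b⟩ = if a = b then c else 0}

/-- The trace inner product `⟨x, y⟩ = tr (x y)`. -/
def tip (x y : Mat r n) : ℝ := (x * y).trace

/-- The homogeneous cone `𝒫 = 𝒵 ∩ Sym₊(N, ℝ)`. -/
def Pcone : Set (Mat r n) := {x | x ∈ Zspace V ∧ x.PosDef}

/-- The dual cone `𝒬 = {ξ ∈ 𝒵 : ⟨ξ, x⟩ > 0 for all nonzero x in the closure of 𝒫}`. -/
def Qcone : Set (Mat r n) :=
  {ξ | ξ ∈ Zspace V ∧ ∀ x ∈ closure (Pcone V), x ≠ 0 → 0 < tip ξ x}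

/-- The group `H` of block lower triangular matrices with strictly lower blocks in `𝒱_{lk}`
and positive scalar diagonal blocks. -/
def Hgrp : Set (Mat r n) :=
  {T | (∀ k l : Fin (r + 1), l < k → blk T l k = 0) ∧
    (∀ k l : Fin (r + 1), k < l → blk T l k ∈ V l k) ∧
    ∀ k : Fin (r + 1), ∃ t : ℝ, 0 < t ∧ ∀ a b : Fin (n k),
      T ⟨k, a⟩ ⟨k, b⟩ = if a = b then t else 0}

/-- `ρ(T) x = T x Tᵀ`. -/
def rhoM (T x : Mat r n) : Mat r n := T * x * Tᵀ

/-- The diagonal scalar `t_{kk}` of a matrix with scalar diagonal blocks. -/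
def tdiag (T : Mat r n) (k : Fin (r + 1)) : ℝ :=
  T ⟨k, ⟨0, (n k).2⟩⟩ ⟨k, ⟨0, (n k).2⟩⟩

/-- The one-dimensional representation `χ_s(T) = ∏_k t_{kk}^{2 s_k}`. -/
noncomputable def chi (s : Fin (r + 1) → ℝ) (T : Mat r n) : ℝ :=
  ∏ k : Fin (r + 1), tdiag T k ^ (2 * s k)

/-- `½ Σ_{i<k} ε_i dim 𝒱_{ki}`. -/
noncomputable def xiBound (ε : Fin (r + 1) → Bool) (k : Fin (r + 1)) : ℝ :=
  (1 / 2) * ∑ i ∈ Finset.univ.filter (fun i => i < k),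
    (if ε i then (Module.finrank ℝ (V k i) : ℝ) else 0)

/-- The Gindikin set `Ξ`. -/
def XiSet : Set (Fin (r + 1) → ℝ) :=
  ⋃ ε : Fin (r + 1) → Bool,
    {s | ∀ k, (ε k = true → xiBound V ε k < s k) ∧ (ε k = false → s k = xiBound V ε k)}

/-- `½ Σ_{l>k} ε_l dim 𝒱_{lk}`. -/
noncomputable def frakBound (ε : Fin (r + 1) → Bool) (k : Fin (r + 1)) : ℝ :=
  (1 / 2) * ∑ l ∈ Finset.univ.filter (fun l => k < l),
    (if ε l then (Module.finrank ℝ (V l k) : ℝ) else 0)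

/-- The Gindikin set `𝔛`. -/
def frakX : Set (Fin (r + 1) → ℝ) :=
  ⋃ ε : Fin (r + 1) → Bool,
    {s | ∀ k, (ε k = true → frakBound V ε k < s k) ∧ (ε k = false → s k = frakBound V ε k)}

/-- Laplace transform `L_μ(θ) = ∫ e^{-⟨θ,x⟩} dμ(x)` (with values in `[0,∞]`). -/
noncomputable def laplace (μ : Measure (Mat r n)) (θ : Mat r n) : ℝ≥0∞ :=
  ∫⁻ x, ENNReal.ofReal (Real.exp (-(tip θ x))) ∂μ

/-- Real-valued Laplace transform. -/
noncomputable def laplaceR (μ : Measure (Mat r n)) (θ : Mat r n) : ℝ :=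
  ∫ x, Real.exp (-(tip θ x)) ∂μ

/-- Mean of the natural-exponential-family member `P(θ,μ)`, computed entrywise:
`m_μ(θ) = L_μ(θ)⁻¹ ∫ x e^{-⟨θ,x⟩} dμ(x)`. -/
noncomputable def meanMap (μ : Measure (Mat r n)) (θ : Mat r n) : Mat r n :=
  Matrix.of fun p q => (laplaceR μ θ)⁻¹ * ∫ x, Real.exp (-(tip θ x)) * x p q ∂μ

/-- Covariance operator of `P(θ,μ)` with mean `m`, applied to `ξ ∈ 𝒵` (entrywise):
`V ξ = ∫ ⟨ξ, x - m⟩ (x - m) dP(θ,μ)(x)`. -/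
noncomputable def varOp (μ : Measure (Mat r n)) (θ m ξ : Mat r n) : Mat r n :=
  Matrix.of fun p q =>
    (laplaceR μ θ)⁻¹ * ∫ x, Real.exp (-(tip θ x)) * tip ξ (x - m) * ((x - m) p q) ∂μ

/-- Leading principal submatrix `y_{{1:k}}` consisting of the blocks with indices `≤ k`. -/
def lead (k : Fin (r + 1)) (y : Mat r n) :
    Matrix {p : Idx r n // p.1 ≤ k} {p : Idx r n // p.1 ≤ k} ℝ :=
  Matrix.of fun p q => y p.1 q.1

/-- Zero-padding `z₀` of a matrix `z` defined on the blocks with indices `≤ k`. -/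
def pad (k : Fin (r + 1)) (z : Matrix {p : Idx r n // p.1 ≤ k} {p : Idx r n // p.1 ≤ k} ℝ) :
    Mat r n :=
  Matrix.of fun p q => if h : p.1 ≤ k ∧ q.1 ≤ k then z ⟨p, h.1⟩ ⟨q, h.2⟩ else 0

/-- `J_k = (I_{N_k})₀`. -/
def Jmat (k : Fin (r + 1)) : Mat r n := pad k 1

/-- Parameters of elements of `W_i`: the scalar `x_{ii}` and the blocks `X_{li}`. -/
abbrev Wparam (r : ℕ) (n : Fin (r + 1) → ℕ+) (i : Fin (r + 1)) :=
  ℝ × ∀ l : Fin (r + 1), Matrix (Fin (n l)) (Fin (n i)) ℝ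

/-- The `N × n_i` matrix in `W_i` with `i`-th block row `x_{ii} I` and `l`-th block row
`X_{li}` for `l > i`. -/
def toW (i : Fin (r + 1)) (p : Wparam r n i) : Matrix (Idx r n) (Fin (n i)) ℝ :=
  Matrix.of fun q b =>
    if q.1 = i then (if (q.2 : ℕ) = (b : ℕ) then p.1 else 0)
    else if i < q.1 then p.2 q.1 q.2 b else 0

/-- A parameter tuple gives an honest element of `W_i`: blocks lie in `𝒱_{li}` and vanish
for `l ≤ i`. -/
def WGood (i : Fin (r + 1)) (p : Wparam r n i) : Prop :=
  (∀ l : Fin (r + 1), i < l → p.2 l ∈ V l i) ∧ (∀ l : Fin (r + 1), ¬ i < l → p.2 l = 0)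

/-- The inner product `(A|B)` on `𝒱_{lk}`, characterized by `(ABᵀ + BAᵀ)/2 = (A|B) I`. -/
noncomputable def bip (l : Fin (r + 1)) {k : Fin (r + 1)}
    (A B : Matrix (Fin (n l)) (Fin (n k)) ℝ) : ℝ :=
  (A * Bᵀ).trace / (n l : ℝ)

open scoped Classical in
/-- The generalized power function `Δ_s` on `𝒫`, defined by `Δ_s(ρ(T) I) = χ_s(T)`. -/
noncomputable def DeltaDef (s : Fin (r + 1) → ℝ) (x : Mat r n) : ℝ :=
  if h : ∃ T, T ∈ Hgrp V ∧ x = rhoM T 1 then chi s h.choose else 0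

/-- Index set for the block diagonal matrix `Φ(ξ) = diag(φ_0(ξ), …, φ_r(ξ))`,
where `φ_i(ξ)` is of size `m_i = mdc i + 1`. -/
abbrev DIdx (r : ℕ) (mdc : Fin (r + 1) → ℕ) := Σ i : Fin (r + 1), Fin (mdc i + 1)

/-- The block diagonal matrix `Φ(ξ) = diag(φ_0(ξ), …, φ_r(ξ))`. -/
def PhiMat {mdc : Fin (r + 1) → ℕ}
    (φ : ∀ i : Fin (r + 1), Mat r n → Matrix (Fin (mdc i + 1)) (Fin (mdc i + 1)) ℝ)
    (ξ : Mat r n) : Matrix (DIdx r mdc) (DIdx r mdc) ℝ :=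
  Matrix.of fun p q =>
    if h : p.1 = q.1 then φ p.1 ξ p.2 (Fin.cast (by rw [h]) q.2) else 0

/-- `Φ(I_N)^{-1/2}`: the inverse square root of the (diagonal, positive) matrix `Φ(I_N)`. -/
noncomputable def PhiISqrtInv {mdc : Fin (r + 1) → ℕ}
    (φ : ∀ i : Fin (r + 1), Mat r n → Matrix (Fin (mdc i + 1)) (Fin (mdc i + 1)) ℝ) :
    Matrix (DIdx r mdc) (DIdx r mdc) ℝ :=
  Matrix.diagonal fun p => (PhiMat φ (1 : Mat r n) p p) ^ (-(1 / 2) : ℝ)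

/-- The Lie algebra of `H`: block lower triangular matrices with strictly lower blocks in
`𝒱_{lk}` and scalar diagonal blocks. -/
def lieAlg : Submodule ℝ (Mat r n) where
  carrier := {T | (∀ k l : Fin (r + 1), l < k → blk T l k = 0) ∧
    (∀ k l : Fin (r + 1), k < l → blk T l k ∈ V l k) ∧
    ∀ k : Fin (r + 1), blk T k k ∈ Submodule.span ℝ {(1 : Matrix (Fin (n k)) (Fin (n k)) ℝ)}}
  zero_mem' := ⟨fun _ _ _ => rfl, fun k l _ => (V l k).zero_mem,
    fun _ => Submodule.zero_mem _⟩
  add_mem' := by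
    rintro A B ⟨hA, hA', hA''⟩ ⟨hB, hB', hB''⟩
    refine ⟨fun k l h => ?_, fun k l h => (V l k).add_mem (hA' k l h) (hB' k l h),
      fun k => Submodule.add_mem _ (hA'' k) (hB'' k)⟩
    change blk A l k + blk B l k = 0
    rw [hA k l h, hB k l h, add_zero]
  smul_mem' := by
    rintro c A ⟨hA, hA', hA''⟩
    refine ⟨fun k l h => ?_, fun k l h => (V l k).smul_mem c (hA' k l h),
      fun k => Submodule.smul_mem _ c (hA'' k)⟩
    change c • blk A l k = 0
    rw [hA k l h, smul_zero]

/-- The space `𝒵` as a linear subspace. -/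
def zSub : Submodule ℝ (Mat r n) where
  carrier := {x | x.IsSymm ∧ (∀ k l : Fin (r + 1), k < l → blk x l k ∈ V l k) ∧
    ∀ k : Fin (r + 1), blk x k k ∈ Submodule.span ℝ {(1 : Matrix (Fin (n k)) (Fin (n k)) ℝ)}}
  zero_mem' := ⟨Matrix.isSymm_zero, fun k l _ => (V l k).zero_mem,
    fun _ => Submodule.zero_mem _⟩
  add_mem' := by
    rintro A B ⟨hA, hA', hA''⟩ ⟨hB, hB', hB''⟩
    exact ⟨hA.add hB, fun k l h => (V l k).add_mem (hA' k l h) (hB' k l h),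
      fun k => Submodule.add_mem _ (hA'' k) (hB'' k)⟩
  smul_mem' := by
    rintro c A ⟨hA, hA', hA''⟩
    exact ⟨hA.smul c, fun k l h => (V l k).smul_mem c (hA' k l h),
      fun k => Submodule.smul_mem _ c (hA'' k)⟩

lemma blk_diag_mem_span_iff (x : Mat r n) (k : Fin (r + 1)) :
    blk x k k ∈ Submodule.span ℝ {(1 : Matrix (Fin (n k)) (Fin (n k)) ℝ)} ↔
      ∃ c : ℝ, ∀ a b : Fin (n k), x ⟨k, a⟩ ⟨k, b⟩ = if a = b then c else 0 := by
  rw [Submodule.mem_span_singleton]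
  refine exists_congr fun c => ?_
  rw [eq_comm, ← Matrix.ext_iff]
  simp [blk, Matrix.one_apply]

lemma mem_zSub_iff (x : Mat r n) : x ∈ zSub V ↔ x ∈ Zspace V := by
  change (_ ∧ _ ∧ _) ↔ (_ ∧ _ ∧ _)
  simp only [blk_diag_mem_span_iff]

variable {V}

lemma lieAlg_apply_eq_zero {T : Mat r n} (hT : T ∈ lieAlg V) {p q : Idx r n} (hpq : p ≠ q)
    (h : p.1 ≤ q.1) : T p q = 0 := by
  obtain ⟨k, a⟩ := p
  obtain ⟨l, b⟩ := q
  rcases h.lt_or_eq with h | h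
  · exact congrFun (congrFun (hT.1 l k h) a) b
  · obtain rfl : k = l := h
    obtain ⟨c, hc⟩ := (blk_diag_mem_span_iff T k).1 (hT.2.2 k)
    rw [hc, if_neg]
    rintro rfl
    exact hpq rfl

lemma mem_Hgrp_iff {T : Mat r n} : T ∈ Hgrp V ↔ T ∈ lieAlg V ∧ ∀ p, 0 < T p p := by
  constructor
  · rintro ⟨h1, h2, h3⟩
    refine ⟨⟨h1, h2, fun k => (blk_diag_mem_span_iff T k).2 ?_⟩, ?_⟩
    · obtain ⟨t, -, ht⟩ := h3 k
      exact ⟨t, ht⟩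
    · rintro ⟨k, a⟩
      obtain ⟨t, h0, ht⟩ := h3 k
      simpa [ht] using h0
  · rintro ⟨⟨h1, h2, h3⟩, hpos⟩
    refine ⟨h1, h2, fun k => ?_⟩
    obtain ⟨t, ht⟩ := (blk_diag_mem_span_iff T k).1 (h3 k)
    refine ⟨t, ?_, ht⟩
    simpa [ht] using hpos ⟨k, ⟨0, (n k).2⟩⟩

lemma blk_one_ne {k l : Fin (r + 1)} (h : k ≠ l) : blk (1 : Mat r n) k l = 0 := by
  ext a b
  simp [blk, h]

lemma blk_one_self (k : Fin (r + 1)) : blk (1 : Mat r n) k k = 1 := by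
  ext a b
  simp [blk, Matrix.one_apply]

lemma one_mem_lieAlg : (1 : Mat r n) ∈ lieAlg V := by
  refine ⟨fun k l h => blk_one_ne h.ne, fun k l h => ?_, fun k => ?_⟩
  · rw [blk_one_ne h.ne']
    exact zero_mem _
  · rw [blk_one_self]
    exact Submodule.mem_span_singleton_self _

lemma one_mem_Hgrp : (1 : Mat r n) ∈ Hgrp V :=
  mem_Hgrp_iff.2 ⟨one_mem_lieAlg, fun p => by simp⟩

lemma one_mem_zSub : (1 : Mat r n) ∈ zSub V :=
  ⟨Matrix.isSymm_one, (one_mem_lieAlg (V := V)).2.1, (one_mem_lieAlg (V := V)).2.2⟩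

lemma blk_mul (A B : Mat r n) (l k : Fin (r + 1)) :
    blk (A * B) l k = ∑ i, blk A l i * blk B i k := by
  ext a b
  simp [blk, Matrix.mul_apply, Matrix.sum_apply, Fintype.sum_sigma]

lemma blk_transpose (A : Mat r n) (l k : Fin (r + 1)) : blk Aᵀ l k = (blk A k l)ᵀ := rfl

lemma mul_mem_lieAlg (hV1 : CondV1 V) {A B : Mat r n} (hA : A ∈ lieAlg V) (hB : B ∈ lieAlg V) :
    A * B ∈ lieAlg V := by
  obtain ⟨hA1, hA2, hA3⟩ := hA
  obtain ⟨hB1, hB2, hB3⟩ := hB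
  refine ⟨fun k l h => ?_, fun k l h => ?_, fun k => ?_⟩
  · rw [blk_mul]
    refine Finset.sum_eq_zero fun i _ => ?_
    rcases lt_or_ge l i with hi | hi
    · rw [hA1 i l hi, Matrix.zero_mul]
    · rw [hB1 k i (hi.trans_lt h), Matrix.mul_zero]
  · rw [blk_mul]
    refine Submodule.sum_mem _ fun i _ => ?_
    rcases lt_trichotomy i k with hi | rfl | hi
    · rw [hB1 k i hi, Matrix.mul_zero]
      exact zero_mem _
    · obtain ⟨c, hc⟩ := Submodule.mem_span_singleton.1 (hB3 i)
      rw [← hc, Matrix.mul_smul, Matrix.mul_one]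
      exact Submodule.smul_mem _ _ (hA2 i l h)
    · rcases lt_trichotomy i l with hi' | rfl | hi'
      · exact hV1 k i l hi hi' _ (hA2 i l hi') _ (hB2 k i hi)
      · obtain ⟨c, hc⟩ := Submodule.mem_span_singleton.1 (hA3 i)
        rw [← hc, Matrix.smul_mul, Matrix.one_mul]
        exact Submodule.smul_mem _ _ (hB2 k i h)
      · rw [hA1 i l hi', Matrix.zero_mul]
        exact zero_mem _
  · rw [blk_mul]
    refine Submodule.sum_mem _ fun i _ => ?_
    rcases lt_trichotomy i k with hi | rfl | hi
    · rw [hB1 k i hi, Matrix.mul_zero]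
      exact zero_mem _
    · obtain ⟨c, hc⟩ := Submodule.mem_span_singleton.1 (hB3 i)
      rw [← hc, Matrix.mul_smul, Matrix.mul_one]
      exact Submodule.smul_mem _ _ (hA3 i)
    · rw [hA1 i k hi, Matrix.zero_mul]
      exact zero_mem _

lemma mul_transpose_self_mem_zSub (hV2 : CondV2 V) (hV3 : CondV3 V) {A : Mat r n}
    (hA : A ∈ lieAlg V) : A * Aᵀ ∈ zSub V := by
  obtain ⟨hA1, hA2, hA3⟩ := hA
  refine ⟨by simp [Matrix.IsSymm], fun k l h => ?_, fun k => ?_⟩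
  · rw [blk_mul]
    refine Submodule.sum_mem _ fun i _ => ?_
    rw [blk_transpose]
    rcases lt_trichotomy i k with hi | rfl | hi
    · exact hV2 i k l hi h _ (hA2 i l (hi.trans h)) _ (hA2 i k hi)
    · obtain ⟨c, hc⟩ := Submodule.mem_span_singleton.1 (hA3 i)
      rw [← hc, Matrix.transpose_smul, Matrix.transpose_one, Matrix.mul_smul, Matrix.mul_one]
      exact Submodule.smul_mem _ _ (hA2 i l h)
    · rw [hA1 i k hi, Matrix.transpose_zero, Matrix.mul_zero]
      exact zero_mem _
  · rw [blk_mul]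
    refine Submodule.sum_mem _ fun i _ => ?_
    rw [blk_transpose]
    rcases lt_trichotomy i k with hi | rfl | hi
    · obtain ⟨c, hc⟩ := hV3 i k hi _ (hA2 i k hi)
      rw [hc]
      exact Submodule.smul_mem _ _ (Submodule.mem_span_singleton_self _)
    · obtain ⟨c, hc⟩ := Submodule.mem_span_singleton.1 (hA3 i)
      rw [← hc, Matrix.transpose_smul, Matrix.transpose_one, Matrix.mul_smul, Matrix.mul_one]
      exact Submodule.smul_mem _ _ (Submodule.smul_mem _ _ (Submodule.mem_span_singleton_self _))
    · rw [hA1 i k hi, Matrix.zero_mul]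
      exact zero_mem _

lemma mul_transpose_add_mem_zSub (hV2 : CondV2 V) (hV3 : CondV3 V) {A B : Mat r n}
    (hA : A ∈ lieAlg V) (hB : B ∈ lieAlg V) : A * Bᵀ + B * Aᵀ ∈ zSub V := by
  have h := (zSub V).sub_mem ((zSub V).sub_mem
    (mul_transpose_self_mem_zSub hV2 hV3 ((lieAlg V).add_mem hA hB))
    (mul_transpose_self_mem_zSub hV2 hV3 hA)) (mul_transpose_self_mem_zSub hV2 hV3 hB)
  convert h using 1
  rw [Matrix.transpose_add]
  noncomm_ring

/-- Every element of `𝒵` is the symmetrization of an element of the Lie algebra. -/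
lemma exists_lieAlg_add_transpose {x : Mat r n} (hx : x ∈ zSub V) :
    ∃ X ∈ lieAlg V, x = X + Xᵀ := by
  let X : Mat r n := Matrix.of fun p q =>
    if p.1 < q.1 then 0 else if p.1 = q.1 then (1 / 2) * x p q else x p q
  have hsymm : ∀ p q, x q p = x p q := fun p q => hx.1.apply p q
  refine ⟨X, ⟨fun k l h => ?_, fun k l h => ?_, fun k => ?_⟩, ?_⟩
  · ext a b
    simp [X, blk, h]
  · have : blk X l k = blk x l k := by
      ext a b
      simp [X, blk, h.not_gt, h.ne']
    rw [this]
    exact hx.2.1 k l h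
  · have : blk X k k = (1 / 2 : ℝ) • blk x k k := by
      ext a b
      simp [X, blk]
    rw [this]
    exact Submodule.smul_mem _ _ (hx.2.2 k)
  · ext p q
    rcases lt_trichotomy p.1 q.1 with h | h | h
    · simp [X, h, h.not_gt, h.ne', hsymm]
    · simp only [X, h, Matrix.add_apply, Matrix.of_apply, Matrix.transpose_apply, lt_irrefl,
        if_false, if_true, hsymm p q]
      ring
    · simp [X, h, h.not_gt, h.ne']

lemma rhoM_mem_zSub (hV1 : CondV1 V) (hV2 : CondV2 V) (hV3 : CondV3 V) {S x : Mat r n}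
    (hS : S ∈ lieAlg V) (hx : x ∈ zSub V) : rhoM S x ∈ zSub V := by
  obtain ⟨X, hX, rfl⟩ := exists_lieAlg_add_transpose hx
  have h := mul_transpose_add_mem_zSub hV2 hV3 (mul_mem_lieAlg hV1 hS hX) hS
  convert h using 1
  rw [rhoM, Matrix.transpose_mul]
  noncomm_ring

lemma mul_apply_diag {A B : Mat r n} (hA : A ∈ lieAlg V) (hB : B ∈ lieAlg V) (p : Idx r n) :
    (A * B) p p = A p p * B p p := by
  rw [Matrix.mul_apply]
  refine Finset.sum_eq_single p (fun q _ hq => ?_) (by simp)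
  rcases le_total p.1 q.1 with h | h
  · rw [lieAlg_apply_eq_zero hA hq.symm h, zero_mul]
  · rw [lieAlg_apply_eq_zero hB hq h, mul_zero]

lemma mul_mem_Hgrp (hV1 : CondV1 V) {A B : Mat r n} (hA : A ∈ Hgrp V) (hB : B ∈ Hgrp V) :
    A * B ∈ Hgrp V := by
  rw [mem_Hgrp_iff] at *
  refine ⟨mul_mem_lieAlg hV1 hA.1 hB.1, fun p => ?_⟩
  rw [mul_apply_diag hA.1 hB.1]
  exact mul_pos (hA.2 p) (hB.2 p)

lemma smul_mem_Hgrp {c : ℝ} (hc : 0 < c) {A : Mat r n} (hA : A ∈ Hgrp V) : c • A ∈ Hgrp V := by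
  rw [mem_Hgrp_iff] at *
  exact ⟨(lieAlg V).smul_mem c hA.1, fun p => mul_pos hc (hA.2 p)⟩

lemma isUnit_det_of_mem_Hgrp {T : Mat r n} (hT : T ∈ Hgrp V) : IsUnit T.det := by
  rw [mem_Hgrp_iff] at hT
  have hbt : T.BlockTriangular (fun p : Idx r n => OrderDual.toDual p.1) := by
    intro p q hpq
    have hlt : p.1 < q.1 := hpq
    exact lieAlg_apply_eq_zero hT.1 (fun h => hlt.ne (congrArg Sigma.fst h)) hlt.le
  rw [hbt.det_fintype, isUnit_iff_ne_zero, Finset.prod_ne_zero_iff]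
  intro k _
  have hd : T.toSquareBlock (fun p : Idx r n => OrderDual.toDual p.1) k =
      Matrix.diagonal fun p => T p.1 p.1 := by
    ext p q
    rcases eq_or_ne p q with rfl | hpq
    · simp [Matrix.toSquareBlock, Matrix.toSquareBlockProp]
    · rw [Matrix.diagonal_apply_ne _ hpq]
      refine lieAlg_apply_eq_zero hT.1 (fun h => hpq (Subtype.ext h)) (le_of_eq ?_)
      exact OrderDual.toDual.injective (p.2.trans q.2.symm)
  rw [hd, Matrix.det_diagonal, Finset.prod_ne_zero_iff]
  exact fun p _ => (hT.2 p.1).ne'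

lemma inv_mem_Hgrp (hV1 : CondV1 V) {T : Mat r n} (hT : T ∈ Hgrp V) : T⁻¹ ∈ Hgrp V := by
  have hu := isUnit_det_of_mem_Hgrp hT
  rw [mem_Hgrp_iff] at hT
  let L : lieAlg V →ₗ[ℝ] lieAlg V :=
    (LinearMap.mulLeft ℝ T).restrict fun X hX => mul_mem_lieAlg hV1 hT.1 hX
  have hinj : Function.Injective L := by
    intro X Y hXY
    have h : T * X.1 = T * Y.1 := congrArg Subtype.val hXY
    have h' := congrArg (T⁻¹ * ·) h
    simp only [Matrix.nonsing_inv_mul_cancel_left _ _ hu] at h'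
    exact Subtype.ext h'
  obtain ⟨S, hS⟩ := (LinearMap.injective_iff_surjective.1 hinj) ⟨1, one_mem_lieAlg⟩
  have hTS : T * S.1 = 1 := congrArg Subtype.val hS
  rw [Matrix.inv_eq_right_inv hTS]
  refine mem_Hgrp_iff.2 ⟨S.2, fun p => ?_⟩
  have h := mul_apply_diag hT.1 S.2 p
  rw [hTS, Matrix.one_apply_eq] at h
  exact pos_of_mul_pos_right (by rw [← h]; exact one_pos) (hT.2 p).le

lemma tip_rhoM_transpose (T x y : Mat r n) : tip (rhoM Tᵀ x) y = tip x (rhoM T y) := by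
  simp only [tip, rhoM, Matrix.transpose_transpose, Matrix.mul_assoc]
  rw [Matrix.trace_mul_comm]
  simp only [Matrix.mul_assoc]

lemma eq_zero_of_tip_self {x : Mat r n} (hx : x ∈ zSub V) (h : tip x x = 0) : x = 0 := by
  have h' : (x * xᴴ).trace = 0 := by
    rwa [Matrix.conjTranspose_eq_transpose_of_trivial, hx.1.eq]
  exact Matrix.trace_mul_conjTranspose_self_eq_zero_iff.1 h'

lemma eq_of_tip_eq {x y : Mat r n} (hx : x ∈ zSub V) (hy : y ∈ zSub V)
    (h : ∀ a ∈ zSub V, tip x a = tip y a) : x = y := by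
  have hd := (zSub V).sub_mem hx hy
  refine sub_eq_zero.1 (eq_zero_of_tip_self hd ?_)
  have := h _ hd
  simp only [tip] at this ⊢
  rw [Matrix.sub_mul, Matrix.trace_sub, this, sub_self]

lemma chi_neg_inv (hV1 : CondV1 V) {T : Mat r n} (hT : T ∈ Hgrp V) (s : Fin (r + 1) → ℝ) :
    chi (-s) T⁻¹ = chi s T := by
  have hS := inv_mem_Hgrp hV1 hT
  have hu := isUnit_det_of_mem_Hgrp hT
  rw [mem_Hgrp_iff] at hT hS
  refine Finset.prod_congr rfl fun k _ => ?_
  have h := mul_apply_diag hT.1 hS.1 ⟨k, ⟨0, (n k).2⟩⟩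
  rw [Matrix.mul_nonsing_inv _ hu, Matrix.one_apply_eq] at h
  have hinv : tdiag T⁻¹ k = (tdiag T k)⁻¹ := (inv_eq_of_mul_eq_one_right h.symm).symm
  have hp : 0 < tdiag T k := hT.2 _
  rw [hinv, Pi.neg_apply, mul_neg, Real.rpow_neg (inv_nonneg.2 hp.le), Real.inv_rpow hp.le,
    inv_inv]

/-- First-order condition for the maximality of `(det T)² / q(T) ^ N` along a curve. -/
lemma first_order_condition {ι : Type*} [Fintype ι] [Nonempty ι] (x : ι → ℝ) {q b c : ℝ}
    (hq : 0 < q)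
    (h : ∀ᶠ ε : ℝ in nhds 0,
      (∏ i, (1 + ε * x i)) ^ 2 * q ^ Fintype.card ι ≤
        (q + ε * b + ε ^ 2 * c) ^ Fintype.card ι) :
    2 * q * ∑ i, x i = Fintype.card ι * b := by
  classical
  obtain ⟨m, hm⟩ : ∃ m, Fintype.card ι = m + 1 :=
    ⟨_, (Nat.succ_pred_eq_of_pos Fintype.card_pos).symm⟩
  have h1 : HasDerivAt (fun ε : ℝ => ∏ i, (1 + ε * x i)) (∑ i, x i) 0 := by
    have := HasDerivAt.fun_finsetProd (u := Finset.univ) (x := (0 : ℝ))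
      (f := fun i (ε : ℝ) => 1 + ε * x i) (f' := x)
      (fun i _ => by simpa using ((hasDerivAt_id (0 : ℝ)).mul_const (x i)).const_add 1)
    simpa using this
  have h2 : HasDerivAt (fun ε : ℝ => q + ε * b + ε ^ 2 * c) b 0 := by
    have := (((hasDerivAt_id (0 : ℝ)).mul_const b).const_add q).fun_add
      ((hasDerivAt_pow 2 (0 : ℝ)).mul_const c)
    simpa using this
  have h3 := ((h1.fun_pow 2).mul_const (q ^ Fintype.card ι)).fun_sub
    (h2.fun_pow (Fintype.card ι))
  have hmax : IsLocalMax (fun ε : ℝ => (∏ i, (1 + ε * x i)) ^ 2 * q ^ Fintype.card ι -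
      (q + ε * b + ε ^ 2 * c) ^ Fintype.card ι) 0 := by
    filter_upwards [h] with ε hε
    simpa using hε
  have h4 := hmax.hasDerivAt_eq_zero h3
  simp only [hm, zero_mul, add_zero, Finset.prod_const_one, one_pow, mul_one,
    Nat.add_sub_cancel, ne_eq, OfNat.ofNat_ne_zero, not_false_eq_true, zero_pow,
    pow_succ q] at h4 ⊢
  have h5 : q ^ m * (2 * q * ∑ i, x i - ((m + 1 : ℕ) : ℝ) * b) = 0 := by
    rw [← h4]
    push_cast
    ring
  rcases mul_eq_zero.1 h5 with h6 | h6
  · exact absurd h6 (pow_pos hq m).ne'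
  · exact sub_eq_zero.1 h6

lemma exists_maximizer (q : Mat r n → ℝ) (hqc : Continuous q)
    (hq2 : ∀ (a : ℝ) (T : Mat r n), q (a • T) = a ^ 2 * q T)
    (hpos : ∀ T ∈ lieAlg V, (∀ p, 0 ≤ T p p) → T ≠ 0 → 0 < q T) :
    ∃ T₁ ∈ Hgrp V, 0 < q T₁ ∧ ∀ T ∈ Hgrp V,
      (∏ p, T p p) ^ 2 * q T₁ ^ Fintype.card (Idx r n) ≤
        (∏ p, T₁ p p) ^ 2 * q T ^ Fintype.card (Idx r n) := by
  let : NormedAddCommGroup (Mat r n) := Matrix.normedAddCommGroup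
  let : NormedSpace ℝ (Mat r n) := Matrix.normedSpace
  have : ProperSpace (Mat r n) := FiniteDimensional.proper ℝ _
  set N := Fintype.card (Idx r n) with hN
  let K : Set (Mat r n) :=
    Metric.sphere 0 1 ∩ ((lieAlg V : Set (Mat r n)) ∩ {T | ∀ p, 0 ≤ T p p})
  have hKc : IsCompact K := by
    refine (isCompact_sphere _ _).inter_right
      ((Submodule.closed_of_finiteDimensional _).inter ?_)
    simp only [Set.ofPred_forall]
    exact isClosed_iInter fun p => isClosed_le continuous_const (by fun_prop)
  have hKne : ∀ T ∈ K, T ≠ 0 := fun T hT => ne_zero_of_mem_unit_sphere ⟨T, hT.1⟩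
  have hKq : ∀ T ∈ K, 0 < q T := fun T hT => hpos T hT.2.1 hT.2.2 (hKne T hT)
  have hHne : ∀ T ∈ Hgrp V, T ≠ 0 := by
    rintro T hT rfl
    exact lt_irrefl _ ((mem_Hgrp_iff.1 hT).2 ⟨0, ⟨0, (n 0).2⟩⟩)
  have hHK : ∀ T ∈ Hgrp V, ‖T‖⁻¹ • T ∈ K := by
    intro T hT
    have hn : 0 < ‖T‖ := norm_pos_iff.2 (hHne T hT)
    have hm := mem_Hgrp_iff.1 (smul_mem_Hgrp (inv_pos.2 hn) hT)
    refine ⟨?_, hm.1, fun p => (hm.2 p).le⟩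
    rw [mem_sphere_zero_iff_norm, norm_smul, norm_inv, norm_norm, inv_mul_cancel₀ hn.ne']
  let f : Mat r n → ℝ := fun T => (∏ p, T p p) ^ 2 / q T ^ N
  have hfc : ContinuousOn f K := by
    refine ContinuousOn.div (Continuous.continuousOn (by fun_prop))
      (hqc.pow N).continuousOn fun T hT => (pow_pos (hKq T hT) N).ne'
  have hfs : ∀ (a : ℝ) (T : Mat r n), a ≠ 0 → f (a • T) = f T := by
    intro a T ha
    have hprod : ∏ p, (a • T) p p = a ^ N * ∏ p, T p p := by
      simp [Finset.prod_mul_distrib, hN]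
    simp only [f, hprod, hq2, mul_pow]
    rw [← pow_mul, ← pow_mul, mul_comm N 2, mul_div_mul_left _ _ (pow_ne_zero _ ha)]
  obtain ⟨T₁, hT₁, hmax⟩ := hKc.exists_isMaxOn ⟨_, hHK 1 one_mem_Hgrp⟩ hfc
  have hle : ∀ T ∈ Hgrp V, f T ≤ f T₁ := by
    intro T hT
    rw [← hfs ‖T‖⁻¹ T (inv_ne_zero (norm_ne_zero_iff.2 (hHne T hT)))]
    exact hmax (hHK T hT)
  have hHq : ∀ T ∈ Hgrp V, 0 < q T := fun T hT =>
    hpos T (mem_Hgrp_iff.1 hT).1 (fun p => ((mem_Hgrp_iff.1 hT).2 p).le) (hHne T hT)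
  have hT₁H : T₁ ∈ Hgrp V := by
    refine mem_Hgrp_iff.2 ⟨hT₁.2.1, fun p => (hT₁.2.2 p).lt_of_ne' fun h0 => ?_⟩
    have h1 : f T₁ = 0 := by
      have h2 : ∏ p, T₁ p p = 0 := Finset.prod_eq_zero (Finset.mem_univ p) h0
      simp [f, h2]
    have h2 : 0 < f 1 := by
      have := hHq 1 one_mem_Hgrp
      simp only [f, Matrix.one_apply_eq, Finset.prod_const_one, one_pow]
      positivity
    exact absurd (hle 1 one_mem_Hgrp) (by rw [h1]; exact h2.not_ge)
  refine ⟨T₁, hT₁H, hHq T₁ hT₁H, fun T hT => ?_⟩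
  have h := hle T hT
  exact (div_le_div_iff₀ (pow_pos (hHq T hT) N) (pow_pos (hHq T₁ hT₁H) N)).1 h

lemma eventually_one_add_smul_mem_Hgrp {X : Mat r n} (hX : X ∈ lieAlg V) :
    ∀ᶠ ε : ℝ in nhds 0, 1 + ε • X ∈ Hgrp V := by
  have h : ∀ᶠ ε : ℝ in nhds 0, ∀ p, 0 < 1 + ε * X p p := by
    rw [Filter.eventually_all]
    intro p
    have hc : Continuous fun ε : ℝ => 1 + ε * X p p := by fun_prop
    exact hc.continuousAt.eventually_const_lt (by simp)
  filter_upwards [h] with ε hε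
  refine mem_Hgrp_iff.2 ⟨(lieAlg V).add_mem one_mem_lieAlg ((lieAlg V).smul_mem ε hX), ?_⟩
  simpa using hε

lemma critical_point {q : Mat r n → ℝ} {T₁ : Mat r n} (hT₁ : T₁ ∈ Hgrp V) (hq : 0 < q T₁)
    (hmax : ∀ T ∈ Hgrp V,
      (∏ p, T p p) ^ 2 * q T₁ ^ Fintype.card (Idx r n) ≤
        (∏ p, T₁ p p) ^ 2 * q T ^ Fintype.card (Idx r n))
    {X : Mat r n} {γ : ℝ → Mat r n} (hγ : ∀ᶠ ε : ℝ in nhds 0, γ ε ∈ Hgrp V)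
    (hγd : ∀ ε p, γ ε p p = T₁ p p * (1 + ε * X p p))
    {b c : ℝ} (hγq : ∀ ε, q (γ ε) = q T₁ + ε * b + ε ^ 2 * c) :
    q T₁ * tip 1 (X + Xᵀ) = Fintype.card (Idx r n) * b := by
  have : Nonempty (Idx r n) := ⟨⟨0, ⟨0, (n 0).2⟩⟩⟩
  have htr : tip 1 (X + Xᵀ) = 2 * ∑ p, X p p := by
    rw [tip, Matrix.one_mul, Matrix.trace_add, Matrix.trace_transpose, Matrix.trace, two_mul]
    rfl
  rw [htr, ← first_order_condition (fun p => X p p) hq (b := b) (c := c)]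
  · ring
  filter_upwards [hγ] with ε hε
  have h := hmax _ hε
  simp only [hγd, hγq, Finset.prod_mul_distrib, mul_pow, mul_assoc] at h
  refine le_of_mul_le_mul_left h (pow_pos (Finset.prod_pos fun p _ => ?_) 2)
  exact (mem_Hgrp_iff.1 hT₁).2 p

lemma rhoM_smul (c : ℝ) (T x : Mat r n) : rhoM (c • T) x = c ^ 2 • rhoM T x := by
  simp [rhoM, smul_smul, sq]

lemma rhoM_mul (S T x : Mat r n) : rhoM (S * T) x = rhoM S (rhoM T x) := by
  simp only [rhoM, Matrix.transpose_mul, Matrix.mul_assoc]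

lemma rhoM_one_left (x : Mat r n) : rhoM 1 x = x := by simp [rhoM]

lemma tip_smul_left (c : ℝ) (x y : Mat r n) : tip (c • x) y = c * tip x y := by
  simp [tip]

lemma tip_smul_right (c : ℝ) (x y : Mat r n) : tip x (c • y) = c * tip x y := by
  simp [tip]

lemma tip_add_right (x y z : Mat r n) : tip x (y + z) = tip x y + tip x z := by
  simp [tip, Matrix.mul_add]

lemma rhoM_one_add_smul (X : Mat r n) (ε : ℝ) (x : Mat r n) :
    rhoM (1 + ε • X) x = x + ε • (X * x + x * Xᵀ) + ε ^ 2 • rhoM X x := by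
  simp only [rhoM, Matrix.transpose_add, Matrix.transpose_one, Matrix.transpose_smul,
    Matrix.add_mul, Matrix.mul_add, Matrix.one_mul, Matrix.mul_one, Matrix.smul_mul,
    Matrix.mul_smul, smul_add, smul_smul, sq]
  abel

lemma card_Idx_pos : (0 : ℝ) < Fintype.card (Idx r n) := by
  have : Nonempty (Idx r n) := ⟨⟨0, ⟨0, (n 0).2⟩⟩⟩
  exact_mod_cast Fintype.card_pos

/-- `H` acts transitively on the cone `𝒫`. -/
lemma exists_rhoM_eq_of_mem_Pcone (hV1 : CondV1 V) (hV2 : CondV2 V) (hV3 : CondV3 V)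
    {x : Mat r n} (hx : x ∈ Pcone V) : ∃ T ∈ Hgrp V, x = rhoM T 1 := by
  obtain ⟨hxZ, hxp⟩ := hx
  rw [← mem_zSub_iff] at hxZ
  obtain ⟨S, hS, hq, hmax⟩ := exists_maximizer (V := V) (fun S => tip 1 (rhoM S x))
    (by unfold tip rhoM; fun_prop)
    (fun a T => by rw [rhoM_smul, tip_smul_right]) (by
      intro T _ _ hT0
      have hps : (rhoM T x).PosSemidef := by
        have := hxp.posSemidef.mul_mul_conjTranspose_same T
        rwa [Matrix.conjTranspose_eq_transpose_of_trivial] at this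
      rw [tip, Matrix.one_mul]
      refine lt_of_le_of_ne hps.trace_nonneg fun h0 => hT0 ?_
      have h1 : T * x * Tᵀ = 0 := (hps.trace_eq_zero_iff).1 h0.symm
      ext p j
      by_contra hne
      have hrow : T p ≠ 0 := fun h => hne (congrFun h j)
      have h2 := hxp.dotProduct_mulVec_pos hrow
      refine h2.ne' ?_
      have h3 := congrFun (congrFun h1 p) p
      rw [Matrix.mul_assoc] at h3
      simpa [Matrix.mul_apply, dotProduct, Matrix.mulVec] using h3)
  have hSl := (mem_Hgrp_iff.1 hS).1
  set N : ℝ := (Fintype.card (Idx r n) : ℝ)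
  set y := rhoM S x with hy
  have hyZ : y ∈ zSub V := rhoM_mem_zSub hV1 hV2 hV3 hSl hxZ
  set q₁ := tip 1 y
  have hcrit : N • y = q₁ • (1 : Mat r n) := by
    refine eq_of_tip_eq ((zSub V).smul_mem _ hyZ) ((zSub V).smul_mem _ one_mem_zSub) fun a ha => ?_
    obtain ⟨X, hX, rfl⟩ := exists_lieAlg_add_transpose ha
    have hmem := eventually_one_add_smul_mem_Hgrp hX
    have hb : tip 1 (X * y + y * Xᵀ) = tip y (X + Xᵀ) := by
      rw [tip_add_right, tip_add_right, tip, tip, tip, tip, Matrix.one_mul, Matrix.one_mul,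
        Matrix.trace_mul_comm X y]
    have h := critical_point (q := fun S => tip 1 (rhoM S x)) hS hq hmax (X := X)
      (γ := fun ε => (1 + ε • X) * S)
      (b := tip 1 (X * y + y * Xᵀ)) (c := tip 1 (rhoM X y))
      (hmem.mono fun ε hε => mul_mem_Hgrp hV1 hε hS)
      (fun ε p => by
        rw [mul_apply_diag ((lieAlg V).add_mem one_mem_lieAlg ((lieAlg V).smul_mem ε hX)) hSl,
          mul_comm]
        simp)
      (fun ε => by
        simp only [rhoM_mul, rhoM_one_add_smul, tip_add_right, tip_smul_right, hy])
    rw [tip_smul_left, tip_smul_left, ← hb]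
    exact h.symm
  have hc : 0 < N / q₁ := div_pos card_Idx_pos hq
  have hT := smul_mem_Hgrp (Real.sqrt_pos.2 hc) hS
  refine ⟨_, inv_mem_Hgrp hV1 hT, ?_⟩
  have h1 : rhoM (√(N / q₁) • S) x = 1 := by
    rw [rhoM_smul, Real.sq_sqrt hc.le, ← hy, div_eq_inv_mul, mul_smul, hcrit, smul_smul,
      inv_mul_cancel₀ hq.ne', one_smul]
  rw [← h1, ← rhoM_mul, Matrix.nonsing_inv_mul _ (isUnit_det_of_mem_Hgrp hT), rhoM_one_left]

lemma rhoM_one_mem_Pcone (hV2 : CondV2 V) (hV3 : CondV3 V) {T : Mat r n} (hT : T ∈ Hgrp V) :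
    rhoM T 1 ∈ Pcone V := by
  rw [rhoM, Matrix.mul_one]
  refine ⟨(mem_zSub_iff V _).1 (mul_transpose_self_mem_zSub hV2 hV3 (mem_Hgrp_iff.1 hT).1), ?_⟩
  rw [← Matrix.conjTranspose_eq_transpose_of_trivial]
  exact Matrix.PosDef.mul_conjTranspose_self T
    (Matrix.vecMul_injective_of_isUnit
      ((Matrix.isUnit_iff_isUnit_det T).2 (isUnit_det_of_mem_Hgrp hT)))

lemma rhoM_one_mem_closure_Pcone (hV2 : CondV2 V) (hV3 : CondV3 V) {T : Mat r n}
    (hT : T ∈ lieAlg V) (hT0 : ∀ p, 0 ≤ T p p) : rhoM T 1 ∈ closure (Pcone V) := by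
  have hc : Continuous fun ε : ℝ => rhoM (T + ε • (1 : Mat r n)) 1 := by
    unfold rhoM
    fun_prop
  have ht := (hc.tendsto 0).mono_left (nhdsWithin_le_nhds (s := Set.Ioi 0))
  simp only [zero_smul, add_zero] at ht
  refine mem_closure_of_tendsto ht ?_
  filter_upwards [self_mem_nhdsWithin] with ε hε
  refine rhoM_one_mem_Pcone hV2 hV3 (mem_Hgrp_iff.2
    ⟨(lieAlg V).add_mem hT ((lieAlg V).smul_mem ε one_mem_lieAlg), fun p => ?_⟩)
  simpa using add_pos_of_nonneg_of_pos (hT0 p) hε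

/-- `H` acts transitively on the dual cone `𝒬` through the adjoint action. -/
lemma exists_tip_eq_of_mem_Qcone (hV1 : CondV1 V) (hV2 : CondV2 V) (hV3 : CondV3 V)
    {ξ : Mat r n} (hξ : ξ ∈ Qcone V) :
    ∃ T ∈ Hgrp V, ∀ a ∈ zSub V, tip ξ a = tip 1 (rhoM T a) := by
  obtain ⟨T, hT, hq, hmax⟩ := exists_maximizer (V := V) (fun T => tip ξ (rhoM T 1))
    (by unfold tip rhoM; fun_prop)
    (fun a T => by rw [rhoM_smul, tip_smul_right]) (by
      intro T hT hd hT0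
      refine hξ.2 _ (rhoM_one_mem_closure_Pcone hV2 hV3 hT hd) fun h => hT0 ?_
      rw [rhoM, Matrix.mul_one, ← Matrix.conjTranspose_eq_transpose_of_trivial] at h
      exact Matrix.self_mul_conjTranspose_eq_zero.1 h)
  have hTl := (mem_Hgrp_iff.1 hT).1
  set N : ℝ := (Fintype.card (Idx r n) : ℝ)
  set q₁ := tip ξ (rhoM T 1)
  have hcrit : ∀ a ∈ zSub V, q₁ * tip 1 a = N * tip ξ (rhoM T a) := by
    intro a ha
    obtain ⟨X, hX, rfl⟩ := exists_lieAlg_add_transpose ha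
    have hmem := eventually_one_add_smul_mem_Hgrp hX
    refine critical_point (q := fun T => tip ξ (rhoM T 1)) hT hq hmax (X := X)
      (γ := fun ε => T * (1 + ε • X))
      (b := tip ξ (rhoM T (X + Xᵀ))) (c := tip ξ (rhoM T (rhoM X 1)))
      (hmem.mono fun ε hε => mul_mem_Hgrp hV1 hT hε)
      (fun ε p => by
        rw [mul_apply_diag hTl ((lieAlg V).add_mem one_mem_lieAlg ((lieAlg V).smul_mem ε hX))]
        simp)
      (fun ε => by
        simp only [rhoM_mul, rhoM_one_add_smul, ← tip_rhoM_transpose T, tip_add_right,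
          tip_smul_right, Matrix.mul_one, Matrix.one_mul])
  have hc : 0 < N / q₁ := div_pos card_Idx_pos hq
  have hS := smul_mem_Hgrp (Real.sqrt_pos.2 hc) hT
  have hS' := inv_mem_Hgrp hV1 hS
  refine ⟨_, hS', fun a ha => ?_⟩
  have hb := rhoM_mem_zSub hV1 hV2 hV3 (mem_Hgrp_iff.1 hS').1 ha
  have h1 : tip ξ (rhoM (√(N / q₁) • T) (rhoM (√(N / q₁) • T)⁻¹ a)) =
      tip 1 (rhoM (√(N / q₁) • T)⁻¹ a) := by
    rw [rhoM_smul, Real.sq_sqrt hc.le, tip_smul_right, div_mul_eq_mul_div, ← hcrit _ hb,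
      mul_div_cancel_left₀ _ hq.ne']
  rw [← h1, ← rhoM_mul, Matrix.mul_nonsing_inv _ (isUnit_det_of_mem_Hgrp hS), rhoM_one_left]

/-- For every `T ∈ H` one has `ρ*(T) = π ∘ ρ(Tᵀ)` as maps `𝒵 → 𝒵`.
Consequently, for every `s`: `Δ_s(x) = δ_{-s}(π(x⁻¹))` for all `x ∈ 𝒫`, or equivalently
`Δ_s(ξ̂⁻¹) = δ_{-s}(ξ)` for all `ξ ∈ 𝒬`. -/
theorem statement19 (r : ℕ) (n : Fin (r + 1) → ℕ+)
    (V : ∀ l k : Fin (r + 1), Submodule ℝ (Matrix (Fin (n l)) (Fin (n k)) ℝ))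
    (hV1 : CondV1 V) (hV2 : CondV2 V) (hV3 : CondV3 V)
    (rstar : Mat r n → Mat r n → Mat r n)
    (hrstar : ∀ T ∈ Hgrp V, ∀ ξ ∈ Zspace V, rstar T ξ ∈ Zspace V ∧
      ∀ x ∈ Zspace V, tip (rstar T ξ) x = tip ξ (rhoM T x))
    (piL : Mat r n → Mat r n)
    (hpi : ∀ x : Mat r n, piL x ∈ Zspace V ∧ ∀ a ∈ Zspace V, tip (piL x) a = tip x a)
    (hat : Mat r n → Mat r n)
    (hhat : ∀ T ∈ Hgrp V, hat (rstar T 1) = Tᵀ * T)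
    (Δf : (Fin (r + 1) → ℝ) → Mat r n → ℝ)
    (hΔ : ∀ s : Fin (r + 1) → ℝ, ∀ T ∈ Hgrp V, Δf s (rhoM T 1) = chi s T)
    (δf : (Fin (r + 1) → ℝ) → Mat r n → ℝ)
    (hδ : ∀ s : Fin (r + 1) → ℝ, ∀ T ∈ Hgrp V, δf s (rstar T 1) = chi s T) :
    (∀ T ∈ Hgrp V, ∀ ξ ∈ Zspace V, rstar T ξ = piL (rhoM Tᵀ ξ)) ∧
    ∀ s : Fin (r + 1) → ℝ,
      (∀ x ∈ Pcone V, Δf s x = δf (-s) (piL x⁻¹)) ∧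
      (∀ ξ ∈ Qcone V, Δf s ((hat ξ)⁻¹) = δf (-s) ξ) := by
  have hone : (1 : Mat r n) ∈ Zspace V := (mem_zSub_iff V _).1 one_mem_zSub
  have hstar : ∀ T ∈ Hgrp V, ∀ ξ ∈ Zspace V, rstar T ξ = piL (rhoM Tᵀ ξ) := by
    intro T hT ξ hξ
    obtain ⟨h1, h2⟩ := hrstar T hT ξ hξ
    obtain ⟨h3, h4⟩ := hpi (rhoM Tᵀ ξ)
    refine eq_of_tip_eq ((mem_zSub_iff V _).2 h1) ((mem_zSub_iff V _).2 h3) fun a ha => ?_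
    rw [mem_zSub_iff] at ha
    rw [h2 a ha, h4 a ha, tip_rhoM_transpose]
  refine ⟨hstar, fun s => ⟨fun x hx => ?_, fun ξ hξ => ?_⟩⟩
  · obtain ⟨T, hT, rfl⟩ := exists_rhoM_eq_of_mem_Pcone hV1 hV2 hV3 hx
    have hT' := inv_mem_Hgrp hV1 hT
    have hinv : (rhoM T 1)⁻¹ = rhoM (T⁻¹)ᵀ 1 := by
      simp only [rhoM, Matrix.mul_one, Matrix.mul_inv_rev, Matrix.transpose_transpose,
        Matrix.transpose_nonsing_inv]
    rw [hΔ s T hT, hinv, ← hstar _ hT' _ hone, hδ _ _ hT', chi_neg_inv hV1 hT]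
  · obtain ⟨T, hT, hTξ⟩ := exists_tip_eq_of_mem_Qcone hV1 hV2 hV3 hξ
    obtain ⟨h1, h2⟩ := hrstar T hT 1 hone
    have hξT : ξ = rstar T 1 := by
      refine eq_of_tip_eq ((mem_zSub_iff V _).2 hξ.1) ((mem_zSub_iff V _).2 h1) fun a ha => ?_
      rw [hTξ a ha, h2 a ((mem_zSub_iff V _).1 ha)]
    have hT' := inv_mem_Hgrp hV1 hT
    have hinv : (Tᵀ * T)⁻¹ = rhoM T⁻¹ 1 := by
      rw [rhoM, Matrix.mul_one, Matrix.mul_inv_rev, Matrix.transpose_nonsing_inv]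
    rw [hξT, hhat T hT, hinv, hΔ s _ hT', hδ _ _ hT, ← chi_neg_inv hV1 hT, neg_neg]

end Wishart
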